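/- arXiv:1509.07679 — 2 statements merged into one kernel-verified Lean document; each statement's English description precedes it below -/
import Mathlib

section
/- Backward graph transform for non-invertible maps: Let γ > 0 with e^{2γ} < 3/2, let 0 ≤ γ₀ ≤ 1, assume ‖B‖‖A⁻¹‖ < 1 and set ξ = 1 − ‖B‖‖A⁻¹‖ ∈ (0,1]. Let φ : B_{k₂}(0,α) → ℂ^{k₁} be a function whose vertical graph {(φ(Y),Y) : ‖Y‖ < α} is contained in B_k(0,R₀), with ‖φ(0)‖ ≤ β and Lip(φ) ≤ γ₀, where β ≤ α ≤ R₀/4. Assume the four inequalities: γ₀(1−ξ) + 2δ(1+γ₀)‖A⁻¹‖ ≤ 1; (γ₀‖B‖ + δ(1+γ₀))·(‖A⁻¹‖⁻¹ − δ(1+γ₀))⁻¹ ≤ e^{−γ}γ₀; (‖B‖ + 2δ)e^{2γ} + δ ≤ 1; and δ(1+γ₀) ≤ min{(‖A⁻¹‖⁻¹ − γ₀‖B‖)/2, ‖A⁻¹‖⁻¹ − e^{2γ}}. Then there exists ψ : B_{k₂}(0, αe^{2γ}) → ℂ^{k₁} with Lip(ψ) ≤ e^{−γ}γ₀, ‖ψ(0)‖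 ≤ βe^{−2γ}, and g(vertical graph of ψ) ⊆ vertical graph of φ. -/
open Metric Set

noncomputable section

/-- ℂ^k with the Euclidean norm. -/
abbrev Eu (k : ℕ) : Type := EuclideanSpace ℂ (Fin k)

/-- ℂ^{k₁} × ℂ^{k₂} with the Euclidean (L²) product norm. -/
abbrev Prod2 (k₁ k₂ : ℕ) : Type := WithLp 2 (Eu k₁ × Eu k₂)

/-- The point (X,Y) of ℂ^{k₁} × ℂ^{k₂}. -/
def mk2 {k₁ k₂ : ℕ} (X : Eu k₁) (Y : Eu k₂) : Prod2 k₁ k₂ :=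
  (WithLp.equiv 2 (Eu k₁ × Eu k₂)).symm (X, Y)

/-- Horizontal coordinate projection π₀. -/
def fst2 {k₁ k₂ : ℕ} (Z : Prod2 k₁ k₂) : Eu k₁ := (WithLp.equiv 2 (Eu k₁ × Eu k₂) Z).1

/-- Vertical coordinate projection π₂. -/
def snd2 {k₁ k₂ : ℕ} (Z : Prod2 k₁ k₂) : Eu k₂ := (WithLp.equiv 2 (Eu k₁ × Eu k₂) Z).2

/-- Horizontal graph {(X, φ(X)) : X ∈ D}. -/
def hgraph {k₁ k₂ : ℕ} (φ : Eu k₁ → Eu k₂) (D : Set (Eu k₁)) : Set (Prod2 k₁ k₂) :=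
  (fun X => mk2 X (φ X)) '' D

/-- Vertical graph {(φ(Y), Y) : Y ∈ D}. -/
def vgraph {k₁ k₂ : ℕ} (φ : Eu k₂ → Eu k₁) (D : Set (Eu k₂)) : Set (Prod2 k₁ k₂) :=
  (fun Y => mk2 (φ Y) Y) '' D

theorem norm_mk2_sub_mk2_le {k₁ k₂ : ℕ} (X X' : Eu k₁) (Y Y' : Eu k₂) :
    ‖mk2 X Y - mk2 X' Y'‖ ≤ ‖X - X'‖ + ‖Y - Y'‖ := by
  have h : ‖mk2 X Y - mk2 X' Y'‖ ^ 2 = ‖X - X'‖ ^ 2 + ‖Y - Y'‖ ^ 2 :=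
    WithLp.prod_norm_sq_eq_of_L2 _
  refine (sq_le_sq₀ (norm_nonneg _) (by positivity)).1 ?_
  nlinarith [norm_nonneg (X - X'), norm_nonneg (Y - Y')]

theorem mk2_zero {k₁ k₂ : ℕ} : mk2 (0 : Eu k₁) (0 : Eu k₂) = 0 := rfl

theorem norm_mk2_le {k₁ k₂ : ℕ} (X : Eu k₁) (Y : Eu k₂) : ‖mk2 X Y‖ ≤ ‖X‖ + ‖Y‖ := by
  simpa [mk2_zero] using norm_mk2_sub_mk2_le X 0 Y 0

/-- A contraction of a closed ball into itself has a fixed point. -/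
theorem exists_fixedPoint_closedBall {E : Type*} [NormedAddCommGroup E] [CompleteSpace E]
    {T : E → E} {r c : ℝ} (hr : 0 ≤ r) (hc0 : 0 ≤ c) (hc1 : c < 1)
    (hmaps : ∀ x, ‖x‖ ≤ r → ‖T x‖ ≤ r)
    (hlip : ∀ x y, ‖x‖ ≤ r → ‖y‖ ≤ r → ‖T x - T y‖ ≤ c * ‖x - y‖) :
    ∃ x, ‖x‖ ≤ r ∧ T x = x := by
  have hmapsTo : MapsTo T (closedBall 0 r) (closedBall 0 r) := fun x hx => by
    simpa using hmaps x (by simpa using hx)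
  have hcontr : ContractingWith ⟨c, hc0⟩ (hmapsTo.restrict T _ _) := by
    refine ⟨by exact_mod_cast hc1, LipschitzWith.of_dist_le_mul fun x y => ?_⟩
    have := hlip x y (mem_closedBall_zero_iff.1 x.2) (mem_closedBall_zero_iff.1 y.2)
    rwa [← dist_eq_norm, ← dist_eq_norm] at this
  obtain ⟨x, hx, hfix, -⟩ := hcontr.exists_fixedPoint' isClosed_closedBall.isComplete hmapsTo
    (mem_closedBall_self hr) (edist_ne_top _ _)
  exact ⟨x, by simpa using hx, hfix⟩

/-- A map with derivative bounded by `δ` on a ball about the origin is `δ`-Lipschitz there for the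
sum norm in the two coordinates. -/
theorem norm_sub_le_of_fderiv_le_ball {k₁ k₂ : ℕ} {F : Type*} [NormedAddCommGroup F]
    [NormedSpace ℂ F] {f : Prod2 k₁ k₂ → F} {ρ δ : ℝ} (hδ : 0 ≤ δ)
    (hf : ∀ Z ∈ ball (0 : Prod2 k₁ k₂) ρ, DifferentiableAt ℂ f Z ∧ ‖fderiv ℂ f Z‖ ≤ δ)
    {X X' : Eu k₁} {Y Y' : Eu k₂} (h : ‖X‖ + ‖Y‖ < ρ) (h' : ‖X'‖ + ‖Y'‖ < ρ) :
    ‖f (mk2 X Y) - f (mk2 X' Y')‖ ≤ δ * (‖X - X'‖ + ‖Y - Y'‖) := by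
  have hmem : ∀ {X : Eu k₁} {Y : Eu k₂}, ‖X‖ + ‖Y‖ < ρ → mk2 X Y ∈ ball 0 ρ := fun h =>
    mem_ball_zero_iff.2 ((norm_mk2_le _ _).trans_lt h)
  let _ : NormedSpace ℝ (Prod2 k₁ k₂) := NormedSpace.restrictScalars ℝ ℂ _
  calc
    _ ≤ δ * ‖mk2 X Y - mk2 X' Y'‖ :=
      (convex_ball 0 ρ).norm_image_sub_le_of_norm_fderiv_le
        (fun Z hZ => (hf Z hZ).1) (fun Z hZ => (hf Z hZ).2) (hmem h') (hmem h)
    _ ≤ _ := mul_le_mul_of_nonneg_left (norm_mk2_sub_mk2_le X X' Y Y') hδ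

/-- Backward graph transform for non-invertible maps. -/
theorem backward_graph_transform
    (k₁ k₂ : ℕ) (hk₁ : 0 < k₁) (hk₂ : 0 < k₂)
    (A : Eu k₁ ≃L[ℂ] Eu k₁) (B : Eu k₂ →L[ℂ] Eu k₂)
    (R : Prod2 k₁ k₂ → Eu k₁) (U : Prod2 k₁ k₂ → Eu k₂)
    (g : Prod2 k₁ k₂ → Prod2 k₁ k₂) (R₀ δ : ℝ)
    (hR₀ : 0 < R₀) (hδ : 0 ≤ δ)
    (hg : ∀ Z, g Z = mk2 (A (fst2 Z) + R Z) (B (snd2 Z) + U Z))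
    (hg0 : g 0 = 0)
    (hRdiff : ∀ Z ∈ ball (0 : Prod2 k₁ k₂) R₀, DifferentiableAt ℂ R Z ∧ ‖fderiv ℂ R Z‖ ≤ δ)
    (hUdiff : ∀ Z ∈ ball (0 : Prod2 k₁ k₂) R₀, DifferentiableAt ℂ U Z ∧ ‖fderiv ℂ U Z‖ ≤ δ)
    (γ γ₀ : ℝ) (hγ : 0 < γ) (hγ32 : Real.exp (2 * γ) < 3 / 2)
    (hγ₀ : 0 ≤ γ₀) (hγ₀1 : γ₀ ≤ 1)
    (hBA : ‖B‖ * ‖(A.symm : Eu k₁ →L[ℂ] Eu k₁)‖ < 1)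
    (φ : Eu k₂ → Eu k₁) (α β : ℝ) (hβα : β ≤ α) (hαR₀ : α ≤ R₀ / 4)
    (hgraphφ : vgraph φ (ball (0 : Eu k₂) α) ⊆ ball (0 : Prod2 k₁ k₂) R₀)
    (hφ0 : ‖φ 0‖ ≤ β)
    (hφlip : ∀ Y₁ ∈ ball (0 : Eu k₂) α, ∀ Y₂ ∈ ball (0 : Eu k₂) α,
      ‖φ Y₁ - φ Y₂‖ ≤ γ₀ * ‖Y₁ - Y₂‖)
    (hineq1 : γ₀ * (‖B‖ * ‖(A.symm : Eu k₁ →L[ℂ] Eu k₁)‖) +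
        2 * δ * (1 + γ₀) * ‖(A.symm : Eu k₁ →L[ℂ] Eu k₁)‖ ≤ 1)
    (hineq2 : (γ₀ * ‖B‖ + δ * (1 + γ₀)) *
        (‖(A.symm : Eu k₁ →L[ℂ] Eu k₁)‖⁻¹ - δ * (1 + γ₀))⁻¹ ≤ Real.exp (-γ) * γ₀)
    (hineq3 : (‖B‖ + 2 * δ) * Real.exp (2 * γ) + δ ≤ 1)
    (hineq4 : δ * (1 + γ₀) ≤
      min ((‖(A.symm : Eu k₁ →L[ℂ] Eu k₁)‖⁻¹ - γ₀ * ‖B‖) / 2)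
        (‖(A.symm : Eu k₁ →L[ℂ] Eu k₁)‖⁻¹ - Real.exp (2 * γ))) :
    ∃ ψ : Eu k₂ → Eu k₁,
      (∀ Y₁ ∈ ball (0 : Eu k₂) (α * Real.exp (2 * γ)),
        ∀ Y₂ ∈ ball (0 : Eu k₂) (α * Real.exp (2 * γ)),
          ‖ψ Y₁ - ψ Y₂‖ ≤ Real.exp (-γ) * γ₀ * ‖Y₁ - Y₂‖) ∧
      ‖ψ 0‖ ≤ β * Real.exp (-(2 * γ)) ∧
      g '' vgraph ψ (ball (0 : Eu k₂) (α * Real.exp (2 * γ))) ⊆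
        vgraph φ (ball (0 : Eu k₂) α) := by
  have hdE := (le_min_iff.1 hineq4).2
  have : Nonempty (Fin k₁) := ⟨⟨0, hk₁⟩⟩
  have ha : 0 < ‖(A.symm : Eu k₁ →L[ℂ] Eu k₁)‖ := by
    rw [norm_pos_iff]
    intro h
    obtain ⟨x, hx⟩ := exists_ne (0 : Eu k₁)
    exact hx (A.symm.injective (by simpa using congrArg (fun L => L x) h))
  have hAsymm : ∀ x : Eu k₁, ‖A.symm x‖ ≤ ‖(A.symm : Eu k₁ →L[ℂ] Eu k₁)‖ * ‖x‖ :=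
    (A.symm : Eu k₁ →L[ℂ] Eu k₁).le_opNorm
  have hexp : Real.exp (-(2 * γ)) = (Real.exp (2 * γ))⁻¹ := Real.exp_neg _
  have hE1 : 1 < Real.exp (2 * γ) := Real.one_lt_exp_iff.2 (by linarith)
  set a := ‖(A.symm : Eu k₁ →L[ℂ] Eu k₁)‖
  set E := Real.exp (2 * γ)
  set d := δ * (1 + γ₀) with hd
  have hd0 : 0 ≤ d := by positivity
  have hB0 : 0 ≤ ‖B‖ := norm_nonneg B
  have haa : a * a⁻¹ = 1 := mul_inv_cancel₀ ha.ne'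
  have haE : a * (E + d) ≤ 1 := by
    rw [← haa]; exact mul_le_mul_of_nonneg_left (by linarith) ha.le
  have had : a * d < 1 := by nlinarith
  have hβ0 : 0 ≤ β := (norm_nonneg _).trans hφ0
  rcases (hβ0.trans hβα).eq_or_lt with hα | hα
  · refine ⟨0, by simp [← hα], ?_, by simp [vgraph, ← hα]⟩
    simpa using mul_nonneg hβ0 (Real.exp_pos _).le
  have hR_zero : R 0 = 0 := by
    have := congrArg fst2 ((hg 0).symm.trans hg0)
    simpa [fst2, mk2] using this
  have hU_zero : U 0 = 0 := by
    have := congrArg snd2 ((hg 0).symm.trans hg0)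
    simpa [snd2, mk2] using this
  set r := α * (1 + E) with hr
  have hdom : ∀ (X : Eu k₁) (Y : Eu k₂), ‖X‖ ≤ r → ‖Y‖ < α * E → ‖X‖ + ‖Y‖ < R₀ := by
    intro X Y hX hY
    nlinarith
  have hr0 : 0 ≤ r := by positivity
  have hαE : 0 < α * E := by positivity
  have h0R : ‖(0 : Eu k₁)‖ + ‖(0 : Eu k₂)‖ < R₀ := by simpa using hR₀
  -- The vertical coordinate of the image stays in the domain of `φ`.
  have hW : ∀ (X : Eu k₁) (Y : Eu k₂), ‖X‖ ≤ r → ‖Y‖ < α * E →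
      B Y + U (mk2 X Y) ∈ ball (0 : Eu k₂) α := by
    intro X Y hX hY
    have h1 := norm_sub_le_of_fderiv_le_ball hδ hUdiff (hdom X Y hX hY) h0R
    rw [mk2_zero, hU_zero, sub_zero, sub_zero, sub_zero] at h1
    have h2 := B.le_opNorm Y
    have h3 := norm_add_le (B Y) (U (mk2 X Y))
    have hδX : δ * ‖X‖ ≤ δ * r := mul_le_mul_of_nonneg_left hX hδ
    rw [mem_ball_zero_iff]
    rcases (add_nonneg hB0 hδ).eq_or_lt with h | h
    · have hB : ‖B‖ = 0 := by linarith
      have hδ' : δ = 0 := by linarith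
      rw [hB] at h2
      rw [hδ'] at h1
      linarith
    · have h4 : (‖B‖ + δ) * ‖Y‖ < (‖B‖ + δ) * (α * E) := mul_lt_mul_of_pos_left hY h
      have h5 : α * ((‖B‖ + 2 * δ) * E + δ) ≤ α * 1 := mul_le_mul_of_nonneg_left hineq3 hα.le
      rw [hr] at hδX
      linarith
  let F : Eu k₁ → Eu k₂ → Eu k₁ := fun X Y => φ (B Y + U (mk2 X Y)) - R (mk2 X Y)
  have hF : ∀ (X X' : Eu k₁) (Y Y' : Eu k₂), ‖X‖ ≤ r → ‖X'‖ ≤ r → ‖Y‖ < α * E →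
      ‖Y'‖ < α * E →
      ‖F X Y - F X' Y'‖ ≤ γ₀ * ‖B‖ * ‖Y - Y'‖ + d * (‖X - X'‖ + ‖Y - Y'‖) := by
    intro X X' Y Y' hX hX' hY hY'
    have h1 := norm_sub_le_of_fderiv_le_ball hδ hUdiff (hdom X Y hX hY) (hdom X' Y' hX' hY')
    have h2 := norm_sub_le_of_fderiv_le_ball hδ hRdiff (hdom X Y hX hY) (hdom X' Y' hX' hY')
    have h3 := hφlip _ (hW X Y hX hY) _ (hW X' Y' hX' hY')
    have h4 : ‖B Y + U (mk2 X Y) - (B Y' + U (mk2 X' Y'))‖ ≤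
        ‖B‖ * ‖Y - Y'‖ + δ * (‖X - X'‖ + ‖Y - Y'‖) := by
      rw [add_sub_add_comm, ← map_sub]
      exact (norm_add_le _ _).trans (add_le_add (B.le_opNorm _) h1)
    have h5 : ‖F X Y - F X' Y'‖ ≤ ‖φ (B Y + U (mk2 X Y)) - φ (B Y' + U (mk2 X' Y'))‖ +
        ‖R (mk2 X Y) - R (mk2 X' Y')‖ := by
      simp only [F]
      rw [sub_sub_sub_comm]
      exact norm_sub_le _ _
    have h6 := mul_le_mul_of_nonneg_left h4 hγ₀
    rw [hd]
    linarith
  have hFnorm : ∀ (X : Eu k₁) (Y : Eu k₂), ‖X‖ ≤ r → ‖Y‖ < α * E →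
      ‖F X Y‖ ≤ β + γ₀ * ‖B‖ * ‖Y‖ + d * (‖X‖ + ‖Y‖) := by
    intro X Y hX hY
    have h1 := hF X 0 Y 0 hX (by simpa using hr0) hY (by simpa using hαE)
    have h2 : F 0 0 = φ 0 := by simp [F, mk2_zero, hR_zero, hU_zero]
    rw [h2, sub_zero, sub_zero] at h1
    have h3 := norm_sub_norm_le (F X Y) (φ 0)
    linarith
  have hfix : ∀ Y : Eu k₂, ∃ X : Eu k₁, ‖Y‖ < α * E → ‖X‖ ≤ r ∧ A.symm (F X Y) = X := by
    intro Y
    by_cases hY : ‖Y‖ < α * E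
    swap
    · exact ⟨0, fun h => absurd h hY⟩
    refine (exists_fixedPoint_closedBall (T := fun X => A.symm (F X Y)) (c := a * d)
      hr0 (by positivity) had (fun X hX => ?_) (fun X X' hX hX' => ?_)).imp fun _ hX _ => hX
    · refine (hAsymm _).trans ?_
      have h1 : ‖F X Y‖ ≤ α + γ₀ * ‖B‖ * (α * E) + d * (r + α * E) := by
        refine (hFnorm X Y hX hY).trans ?_
        gcongr
      have h2 := mul_le_mul_of_nonneg_left h1 ha.le
      have h3 : α * E * (γ₀ * (‖B‖ * a) + 2 * δ * (1 + γ₀) * a) ≤ α * E * 1 :=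
        mul_le_mul_of_nonneg_left hineq1 hαE.le
      have h4 : α * (a * (1 + d)) ≤ α * 1 :=
        mul_le_mul_of_nonneg_left
          ((mul_le_mul_of_nonneg_left (by linarith) ha.le).trans haE) hα.le
      refine h2.trans ?_
      rw [hr]
      rw [hd] at h4 ⊢
      linarith
    · have h1 := hF X X' Y Y hX hX' hY hY
      rw [sub_self, norm_zero, mul_zero, zero_add, add_zero] at h1
      rw [← map_sub, mul_assoc]
      exact (hAsymm _).trans (mul_le_mul_of_nonneg_left h1 ha.le)
  choose ψ hψ using hfix
  have hpos : 0 < a⁻¹ - d := by linarith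
  refine ⟨ψ, ?_, ?_, ?_⟩
  · intro Y₁ hY₁ Y₂ hY₂
    rw [mem_ball_zero_iff] at hY₁ hY₂
    obtain ⟨hr₁, he₁⟩ := hψ Y₁ hY₁
    obtain ⟨hr₂, he₂⟩ := hψ Y₂ hY₂
    have h1 := hF _ _ Y₁ Y₂ hr₁ hr₂ hY₁ hY₂
    have h2 := hAsymm (F (ψ Y₁) Y₁ - F (ψ Y₂) Y₂)
    rw [map_sub, he₁, he₂, ← inv_mul_le_iff₀ ha] at h2
    have h3 : ‖ψ Y₁ - ψ Y₂‖ ≤ (γ₀ * ‖B‖ + d) * ‖Y₁ - Y₂‖ * (a⁻¹ - d)⁻¹ := by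
      rw [← div_eq_mul_inv, le_div_iff₀ hpos]
      linarith
    calc
      _ ≤ (γ₀ * ‖B‖ + d) * (a⁻¹ - d)⁻¹ * ‖Y₁ - Y₂‖ := by rwa [mul_right_comm]
      _ ≤ _ := mul_le_mul_of_nonneg_right hineq2 (norm_nonneg _)
  · have h0 : ‖(0 : Eu k₂)‖ < α * E := by simpa using hαE
    obtain ⟨hr₀, he₀⟩ := hψ 0 h0
    have h1 := hFnorm _ 0 hr₀ h0
    have h2 := hAsymm (F (ψ 0) 0)
    rw [he₀, ← inv_mul_le_iff₀ ha] at h2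
    rw [norm_zero, mul_zero, add_zero, add_zero] at h1
    rw [hexp, ← div_eq_mul_inv, le_div_iff₀ (by linarith)]
    nlinarith [norm_nonneg (ψ 0)]
  · rintro _ ⟨_, ⟨Y, hY, rfl⟩, rfl⟩
    rw [mem_ball_zero_iff] at hY
    obtain ⟨hrY, heY⟩ := hψ Y hY
    refine ⟨B Y + U (mk2 (ψ Y) Y), hW _ Y hrY hY, ?_⟩
    have h1 : F (ψ Y) Y = A (ψ Y) := (A.symm_apply_eq).1 heY
    have h2 : φ (B Y + U (mk2 (ψ Y) Y)) = A (ψ Y) + R (mk2 (ψ Y) Y) := sub_eq_iff_eq_add.1 h1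
    rw [hg]
    simp only [h2]
    rfl
end
end

section
/- Contraction of the backward graph transform in the uniform metric: Let 0 ≤ γ₀ and assume ‖A⁻¹‖⁻¹ − δ(1+γ₀) > 0. Let φ₁, φ₂ : D → ℂ^{k₁} (D ⊆ ℂ^{k₂}) with Lip(φ₁) ≤ γ₀, Lip(φ₂) ≤ γ₀ and vertical graphs contained in B_k(0,R₀), and let ψ₁, ψ₂ be functions (defined on subsets of ℂ^{k₂}) with Lip(ψ₂) ≤ γ₀ such that g(vertical graph of φᵢ) ⊆ vertical graph of ψᵢ for i = 1, 2. Then for every Y ∈ D such that both B Y + U(φ₁(Y),Y) and B Y + U(φ₂(Y),Y) lie in the domains of ψ₁ and ψ₂, one has ‖φ₁(Y) − φ₂(Y)‖ ≤ (‖A⁻¹‖⁻¹ − δ(1+γ₀))⁻¹ · ‖ψ₁(B Y + U(φ₁(Y),Y)) − ψ₂(B Y + U(φ₁(Y),Y))‖. -/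
open Metric Set

noncomputable section

theorem mk2_sub_mk2_left_norm {k₁ k₂ : ℕ} (X W : Eu k₁) (Y : Eu k₂) :
    ‖mk2 X Y - mk2 W Y‖ = ‖X - W‖ := by
  simp [mk2, ← WithLp.toLp_sub]

/-- The value of `ψ` above the image point, when `g` maps the vertical graph of `φ` into that of
`ψ`. -/
theorem vgraph_transform_apply {k₁ k₂ : ℕ} {g : Prod2 k₁ k₂ → Prod2 k₁ k₂}
    {φ ψ : Eu k₂ → Eu k₁} {D E : Set (Eu k₂)} (h : g '' vgraph φ D ⊆ vgraph ψ E)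
    {Y : Eu k₂} (hY : Y ∈ D) :
    ψ (snd2 (g (mk2 (φ Y) Y))) = fst2 (g (mk2 (φ Y) Y)) := by
  obtain ⟨W, -, hW⟩ := h (mem_image_of_mem g (mem_image_of_mem _ hY))
  rw [← hW]
  rfl

theorem inv_norm_symm_mul_norm_le {k : ℕ} (A : Eu k ≃L[ℂ] Eu k) (v : Eu k) :
    ‖(A.symm : Eu k →L[ℂ] Eu k)‖⁻¹ * ‖v‖ ≤ ‖A v‖ := by
  refine inv_mul_le_of_le_mul₀ (norm_nonneg _) (norm_nonneg _) ?_
  simpa using (A.symm : Eu k →L[ℂ] Eu k).le_opNorm (A v)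

theorem norm_sub_le_of_fderiv_le_on_ball {k₁ k₂ l : ℕ} {F : Prod2 k₁ k₂ → Eu l} {r δ : ℝ}
    (hF : ∀ Z ∈ ball (0 : Prod2 k₁ k₂) r, DifferentiableAt ℂ F Z ∧ ‖fderiv ℂ F Z‖ ≤ δ)
    {X W : Eu k₁} {Y : Eu k₂} (h : mk2 X Y ∈ ball (0 : Prod2 k₁ k₂) r)
    (hW : mk2 W Y ∈ ball (0 : Prod2 k₁ k₂) r) :
    ‖F (mk2 X Y) - F (mk2 W Y)‖ ≤ δ * ‖X - W‖ := by
  rw [← mk2_sub_mk2_left_norm X W Y]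
  exact (convex_ball (0 : Prod2 k₁ k₂) r).norm_image_sub_le_of_norm_fderiv_le
    (fun Z hZ => (hF Z hZ).1) (fun Z hZ => (hF Z hZ).2) hW h

/-- Contraction of the backward graph transform in the uniform
metric. -/
theorem backward_graph_transform_uniform_contraction
    (k₁ k₂ : ℕ) (hk₁ : 0 < k₁) (hk₂ : 0 < k₂)
    (A : Eu k₁ ≃L[ℂ] Eu k₁) (B : Eu k₂ →L[ℂ] Eu k₂)
    (R : Prod2 k₁ k₂ → Eu k₁) (U : Prod2 k₁ k₂ → Eu k₂)
    (g : Prod2 k₁ k₂ → Prod2 k₁ k₂) (R₀ δ : ℝ)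
    (hR₀ : 0 < R₀) (hδ : 0 ≤ δ)
    (hg : ∀ Z, g Z = mk2 (A (fst2 Z) + R Z) (B (snd2 Z) + U Z))
    (hg0 : g 0 = 0)
    (hRdiff : ∀ Z ∈ ball (0 : Prod2 k₁ k₂) R₀, DifferentiableAt ℂ R Z ∧ ‖fderiv ℂ R Z‖ ≤ δ)
    (hUdiff : ∀ Z ∈ ball (0 : Prod2 k₁ k₂) R₀, DifferentiableAt ℂ U Z ∧ ‖fderiv ℂ U Z‖ ≤ δ)
    (γ₀ : ℝ) (hγ₀ : 0 ≤ γ₀)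
    (hA : 0 < ‖(A.symm : Eu k₁ →L[ℂ] Eu k₁)‖⁻¹ - δ * (1 + γ₀))
    (φ₁ φ₂ : Eu k₂ → Eu k₁) (D : Set (Eu k₂))
    (hφ₁lip : ∀ Y₁ ∈ D, ∀ Y₂ ∈ D, ‖φ₁ Y₁ - φ₁ Y₂‖ ≤ γ₀ * ‖Y₁ - Y₂‖)
    (hφ₂lip : ∀ Y₁ ∈ D, ∀ Y₂ ∈ D, ‖φ₂ Y₁ - φ₂ Y₂‖ ≤ γ₀ * ‖Y₁ - Y₂‖)
    (hφ₁graph : vgraph φ₁ D ⊆ ball (0 : Prod2 k₁ k₂) R₀)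
    (hφ₂graph : vgraph φ₂ D ⊆ ball (0 : Prod2 k₁ k₂) R₀)
    (ψ₁ ψ₂ : Eu k₂ → Eu k₁) (D₁ D₂ : Set (Eu k₂))
    (hψ₂lip : ∀ Y₁ ∈ D₂, ∀ Y₂ ∈ D₂, ‖ψ₂ Y₁ - ψ₂ Y₂‖ ≤ γ₀ * ‖Y₁ - Y₂‖)
    (hψ₁graph : g '' vgraph φ₁ D ⊆ vgraph ψ₁ D₁)
    (hψ₂graph : g '' vgraph φ₂ D ⊆ vgraph ψ₂ D₂) :
    ∀ Y ∈ D,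
      B Y + U (mk2 (φ₁ Y) Y) ∈ D₁ ∩ D₂ →
      B Y + U (mk2 (φ₂ Y) Y) ∈ D₁ ∩ D₂ →
      ‖φ₁ Y - φ₂ Y‖ ≤
        (‖(A.symm : Eu k₁ →L[ℂ] Eu k₁)‖⁻¹ - δ * (1 + γ₀))⁻¹ *
          ‖ψ₁ (B Y + U (mk2 (φ₁ Y) Y)) - ψ₂ (B Y + U (mk2 (φ₁ Y) Y))‖ := by
  intro Y hY hP₁ hP₂
  have hZ₁ := hφ₁graph (mem_image_of_mem _ hY)
  have hZ₂ := hφ₂graph (mem_image_of_mem _ hY)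
  have hR := norm_sub_le_of_fderiv_le_on_ball hRdiff hZ₁ hZ₂
  have hU := norm_sub_le_of_fderiv_le_on_ball hUdiff hZ₁ hZ₂
  have e₁ : ψ₁ (B Y + U (mk2 (φ₁ Y) Y)) = A (φ₁ Y) + R (mk2 (φ₁ Y) Y) := by
    have h := vgraph_transform_apply hψ₁graph hY
    rw [hg] at h
    exact h
  have e₂ : ψ₂ (B Y + U (mk2 (φ₂ Y) Y)) = A (φ₂ Y) + R (mk2 (φ₂ Y) Y) := by
    have h := vgraph_transform_apply hψ₂graph hY
    rw [hg] at h
    exact h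
  have hψ := hψ₂lip _ hP₁.2 _ hP₂.2
  rw [add_sub_add_left_eq_sub] at hψ
  have hγU := mul_le_mul_of_nonneg_left hU hγ₀
  have hlow := inv_norm_symm_mul_norm_le A (φ₁ Y - φ₂ Y)
  have hsplit : A (φ₁ Y - φ₂ Y) =
      (ψ₁ (B Y + U (mk2 (φ₁ Y) Y)) - ψ₂ (B Y + U (mk2 (φ₁ Y) Y))) +
      (ψ₂ (B Y + U (mk2 (φ₁ Y) Y)) - ψ₂ (B Y + U (mk2 (φ₂ Y) Y))) -
      (R (mk2 (φ₁ Y) Y) - R (mk2 (φ₂ Y) Y)) := by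
    rw [e₁, e₂, map_sub]
    abel
  rw [hsplit] at hlow
  have hup := hlow.trans ((norm_sub_le _ _).trans (add_le_add (norm_add_le _ _) hR))
  rw [le_inv_mul_iff₀ hA]
  linarith
end
end
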